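/- arXiv:1706.04388 — 4 statements merged into one kernel-verified Lean document; each statement's English description precedes it below -/
import Mathlib

section
/- Let n be a positive integer, f : ℝ^{n×n} → ℝ a continuous function, and (Q_l)_{l∈ℕ} a sequence of orthogonal n×n matrices such that f(Q_{l+1}) ≥ f(Q_l) for all l. Let Q̂ be an orthogonal matrix and o : ℕ → ℕ a strictly increasing index map such that Q_{o(l)} converges to Q̂ in the Frobenius norm. Fix indices 1 ≤ p < q ≤ n, and assume that for infinitely many l one has f(Q_{o(l)+1}) ≥ f(G_{p,q}(θ)·Q_{o(l)}) for every θ ∈ ℝ. Then f(G_{p,q}(θ)·Q̂) ≤ f(Q̂) for every θ ∈ ℝ. -/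
open Matrix Filter

/-- The Givens rotation `G_{p,q}(θ)`: the identity matrix except for the entries
`(p,p) = (q,q) = cos θ`, `(p,q) = sin θ`, `(q,p) = -sin θ`. -/
noncomputable def givens {n : ℕ} (p q : Fin n) (θ : ℝ) : Matrix (Fin n) (Fin n) ℝ :=
  Matrix.of fun i j =>
    if i = p ∧ j = p then Real.cos θ
    else if i = q ∧ j = q then Real.cos θ
    else if i = p ∧ j = q then Real.sin θ
    else if i = q ∧ j = p then -Real.sin θ
    else if i = j then 1 else 0

/-- The Frobenius norm `‖M‖_F = √(tr(Mᵀ M))`. -/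
noncomputable def frobNorm {n : ℕ} (M : Matrix (Fin n) (Fin n) ℝ) : ℝ :=
  Real.sqrt (Matrix.trace (Mᵀ * M))

theorem abs_apply_le_frobNorm {n : ℕ} (M : Matrix (Fin n) (Fin n) ℝ) (i j : Fin n) :
    |M i j| ≤ frobNorm M := by
  refine Real.abs_le_sqrt ?_
  simp only [Matrix.trace, Matrix.diag_apply, Matrix.mul_apply, Matrix.transpose_apply, ← pow_two]
  exact (Finset.single_le_sum (f := fun k => M k j ^ 2) (fun k _ => sq_nonneg _)
    (Finset.mem_univ i)).trans
    (Finset.single_le_sum (f := fun c => ∑ k, M k c ^ 2)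
      (fun c _ => Finset.sum_nonneg fun k _ => sq_nonneg _) (Finset.mem_univ j))

theorem tendsto_of_tendsto_frobNorm_sub {n : ℕ} {ι : Type*} {l : Filter ι}
    {A : ι → Matrix (Fin n) (Fin n) ℝ} {B : Matrix (Fin n) (Fin n) ℝ}
    (h : Tendsto (fun k => frobNorm (A k - B)) l (nhds 0)) : Tendsto A l (nhds B) :=
  tendsto_pi_nhds.2 fun i => tendsto_pi_nhds.2 fun j => tendsto_iff_dist_tendsto_zero.2 <|
    squeeze_zero (fun _ => dist_nonneg) (fun k => abs_apply_le_frobNorm (A k - B) i j) h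

/-- Deterministic core of Theorem 1: if along a subsequence converging (in Frobenius
norm) to an accumulation point `Q̂`, the monotone Jacobi iteration infinitely often
dominates every Givens rotation in the plane `(p,q)`, then `Q̂` cannot be improved by
any Givens rotation in that plane. -/
theorem accumulation_point_not_improvable_by_givens
    (n : ℕ) (hn : 0 < n)
    (f : Matrix (Fin n) (Fin n) ℝ → ℝ) (hf : Continuous f)
    (Q : ℕ → Matrix (Fin n) (Fin n) ℝ)
    (hQorth : ∀ l, (Q l)ᵀ * Q l = 1)
    (hmono : ∀ l, f (Q l) ≤ f (Q (l + 1)))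
    (Qhat : Matrix (Fin n) (Fin n) ℝ) (hQhat : Qhatᵀ * Qhat = 1)
    (o : ℕ → ℕ) (ho : StrictMono o)
    (hconv : Tendsto (fun l => frobNorm (Q (o l) - Qhat)) atTop (nhds 0))
    (p q : Fin n) (hpq : p < q)
    (hinf : ∀ L : ℕ, ∃ l ≥ L, ∀ θ : ℝ, f (givens p q θ * Q (o l)) ≤ f (Q (o l + 1))) :
    ∀ θ : ℝ, f (givens p q θ * Qhat) ≤ f Qhat := by
  intro θ
  have hQ := tendsto_of_tendsto_frobNorm_sub hconv
  have hrot : Tendsto (fun l => f (givens p q θ * Q (o l))) atTop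
      (nhds (f (givens p q θ * Qhat))) :=
    (hf.tendsto _).comp (hQ.const_mul _)
  have hnext : Tendsto (fun l => f (Q (o (l + 1)))) atTop (nhds (f Qhat)) :=
    (hf.tendsto _).comp (hQ.comp (tendsto_add_atTop_nat 1))
  refine le_of_tendsto_of_tendsto_of_frequently hrot hnext (frequently_atTop.2 fun L => ?_)
  obtain ⟨l, hl, h⟩ := hinf L
  exact ⟨l, hl, (h θ).trans (monotone_nat_of_le_succ hmono (ho l.lt_succ_self))⟩
end

section
/- The alignment metric satisfies the triangle inequality: for any three system descriptors Θ₁, Θ₂ and Θ₃, d_O(Θ₁, Θ₃) ≤ d_O(Θ₁, Θ₂) + d_O(Θ₂, Θ₃). -/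
open Matrix

/-- A system descriptor `Θ = (A, C, μ)`: an `n×n` real matrix `A`, an `n`-tuple of
vectors `C` in a real inner product space `H`, and a bias `μ ∈ H`. -/
structure Descriptor (n : ℕ) (H : Type*) [NormedAddCommGroup H] [InnerProductSpace ℝ H] where
  A : Matrix (Fin n) (Fin n) ℝ
  C : Fin n → H
  μ : H

variable {n : ℕ} {H : Type*} [NormedAddCommGroup H] [InnerProductSpace ℝ H]

/-- The action of an `n×n` matrix on a descriptor:
`Q·(A, C, μ) = (QᵀAQ, C·Q, μ)` where `(C·Q)(j) = Σ_i Q_{ij} C(i)`. -/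
noncomputable def act (Q : Matrix (Fin n) (Fin n) ℝ) (Θ : Descriptor n H) : Descriptor n H where
  A := Qᵀ * Θ.A * Q
  C := fun j => ∑ i, Q i j • Θ.C i
  μ := Θ.μ

/-- The squared Frobenius distance
`d_F(Θ₁,Θ₂)² = λ_A‖A₁−A₂‖_F² + Σ_j ‖C₁(j)−C₂(j)‖² + λ_μ‖μ₁−μ₂‖²`. -/
noncomputable def dF2 (lamA lamMu : ℝ) (Θ₁ Θ₂ : Descriptor n H) : ℝ :=
  lamA * Matrix.trace ((Θ₁.A - Θ₂.A)ᵀ * (Θ₁.A - Θ₂.A)) +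
    ∑ j, ‖Θ₁.C j - Θ₂.C j‖ ^ 2 + lamMu * ‖Θ₁.μ - Θ₂.μ‖ ^ 2

/-- The alignment distance `d_O(Θ₁,Θ₂)² = inf_{Q ∈ O(n)} d_F(Θ₁, Q·Θ₂)²`. -/
noncomputable def dO2 (lamA lamMu : ℝ) (Θ₁ Θ₂ : Descriptor n H) : ℝ :=
  sInf {d : ℝ | ∃ Q : Matrix (Fin n) (Fin n) ℝ, Qᵀ * Q = 1 ∧ d = dF2 lamA lamMu Θ₁ (act Q Θ₂)}

/-- The action of a product of matrices is the composition of the actions. -/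
theorem act_act (P Q : Matrix (Fin n) (Fin n) ℝ) (Θ : Descriptor n H) :
    act P (act Q Θ) = act (Q * P) Θ := by
  simp only [act, Descriptor.mk.injEq, and_true]
  constructor
  · simp only [Matrix.transpose_mul, Matrix.mul_assoc]
  · funext j
    simp only [Matrix.mul_apply, Finset.smul_sum, Finset.sum_smul, smul_smul]
    rw [Finset.sum_comm]
    simp only [mul_comm]

/-- Combining a tuple of vectors by an orthogonal matrix preserves the total squared norm. -/
theorem sum_norm_sq_orthogonal {Q : Matrix (Fin n) (Fin n) ℝ} (hQ : Qᵀ * Q = 1) (c : Fin n → H) :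
    ∑ j, ‖∑ i, Q i j • c i‖ ^ 2 = ∑ i, ‖c i‖ ^ 2 := by
  have hQ' : ∀ i k, ∑ j, Q i j * Q k j = if i = k then 1 else 0 := fun i k => by
    have hQQ : Q * Qᵀ = 1 := mul_eq_one_comm.mp hQ
    rw [← Matrix.one_apply, ← hQQ]
    simp only [Matrix.mul_apply, Matrix.transpose_apply]
  calc ∑ j, ‖∑ i, Q i j • c i‖ ^ 2
      = ∑ j, ∑ i, ∑ k, Q i j * Q k j * inner ℝ (c i) (c k) := by
        refine Finset.sum_congr rfl fun j _ => ?_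
        rw [← real_inner_self_eq_norm_sq, sum_inner]
        refine Finset.sum_congr rfl fun i _ => ?_
        rw [inner_sum]
        refine Finset.sum_congr rfl fun k _ => ?_
        rw [real_inner_smul_left, real_inner_smul_right, mul_assoc]
    _ = ∑ i, ∑ k, (∑ j, Q i j * Q k j) * inner ℝ (c i) (c k) := by
        rw [Finset.sum_comm]
        refine Finset.sum_congr rfl fun i _ => ?_
        rw [Finset.sum_comm]
        simp only [Finset.sum_mul]
    _ = ∑ i, ‖c i‖ ^ 2 := by
        simp only [hQ', ite_mul, one_mul, zero_mul, Finset.sum_ite_eq, Finset.mem_univ, if_true,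
          real_inner_self_eq_norm_sq]

/-- The squared Frobenius distance is invariant under the orthogonal group. -/
theorem dF2_act_act (lamA lamMu : ℝ) {Q : Matrix (Fin n) (Fin n) ℝ} (hQ : Qᵀ * Q = 1)
    (Θ₁ Θ₂ : Descriptor n H) :
    dF2 lamA lamMu (act Q Θ₁) (act Q Θ₂) = dF2 lamA lamMu Θ₁ Θ₂ := by
  have hA (D : Matrix (Fin n) (Fin n) ℝ) :
      ((Qᵀ * D * Q)ᵀ * (Qᵀ * D * Q)).trace = (Dᵀ * D).trace := by
    have hQ' : Q * Qᵀ = 1 := mul_eq_one_comm.mp hQ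
    calc ((Qᵀ * D * Q)ᵀ * (Qᵀ * D * Q)).trace
        = (Qᵀ * (Dᵀ * (Q * Qᵀ) * D * Q)).trace := by
          simp only [Matrix.transpose_mul, Matrix.transpose_transpose, Matrix.mul_assoc]
      _ = (Dᵀ * D).trace := by
          rw [Matrix.trace_mul_comm, hQ', Matrix.mul_one, Matrix.mul_assoc, hQ', Matrix.mul_one]
  have hC := sum_norm_sq_orthogonal hQ fun i => Θ₁.C i - Θ₂.C i
  simp only [smul_sub, Finset.sum_sub_distrib] at hC
  simp only [dF2, act, hC, ← Matrix.sub_mul, ← Matrix.mul_sub, hA]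

/-- An embedding of descriptors in a Euclidean space realizing the Frobenius distance. -/
noncomputable def Descriptor.embed (lamA lamMu : ℝ) (Θ : Descriptor n H) :
    WithLp 2 (EuclideanSpace ℝ (Fin n × Fin n) × WithLp 2 (PiLp 2 (fun _ : Fin n => H) × H)) :=
  WithLp.toLp 2 (WithLp.toLp 2 fun p => √lamA * Θ.A p.1 p.2,
    WithLp.toLp 2 (WithLp.toLp 2 Θ.C, √lamMu • Θ.μ))

theorem dF2_eq_dist_embed_sq {lamA lamMu : ℝ} (hlamA : 0 ≤ lamA) (hlamMu : 0 ≤ lamMu)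
    (Θ₁ Θ₂ : Descriptor n H) :
    dF2 lamA lamMu Θ₁ Θ₂ = dist (Θ₁.embed lamA lamMu) (Θ₂.embed lamA lamMu) ^ 2 := by
  have hA : lamA * ((Θ₁.A - Θ₂.A)ᵀ * (Θ₁.A - Θ₂.A)).trace
      = ∑ p : Fin n × Fin n, (√lamA * Θ₁.A p.1 p.2 - √lamA * Θ₂.A p.1 p.2) ^ 2 := by
    rw [Fintype.sum_prod_type_right]
    simp only [Matrix.trace, Matrix.diag_apply, Matrix.mul_apply, Matrix.transpose_apply,
      Matrix.sub_apply, Finset.mul_sum, ← mul_sub, mul_pow, Real.sq_sqrt hlamA, pow_two (_ - _)]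
  rw [dist_eq_norm, WithLp.prod_norm_sq_eq_of_L2, WithLp.prod_norm_sq_eq_of_L2,
    PiLp.norm_sq_eq_of_L2, PiLp.norm_sq_eq_of_L2, dF2, hA]
  simp [Descriptor.embed, ← smul_sub, norm_smul, mul_pow, Real.sq_sqrt hlamMu,
    abs_of_nonneg (Real.sqrt_nonneg lamMu), add_assoc]

theorem dF2_nonneg {lamA lamMu : ℝ} (hlamA : 0 ≤ lamA) (hlamMu : 0 ≤ lamMu)
    (Θ₁ Θ₂ : Descriptor n H) : 0 ≤ dF2 lamA lamMu Θ₁ Θ₂ := by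
  rw [dF2_eq_dist_embed_sq hlamA hlamMu]
  positivity

theorem sqrt_dF2_triangle {lamA lamMu : ℝ} (hlamA : 0 ≤ lamA) (hlamMu : 0 ≤ lamMu)
    (Θ₁ Θ₂ Θ₃ : Descriptor n H) :
    √(dF2 lamA lamMu Θ₁ Θ₃) ≤ √(dF2 lamA lamMu Θ₁ Θ₂) + √(dF2 lamA lamMu Θ₂ Θ₃) := by
  simp only [dF2_eq_dist_embed_sq hlamA hlamMu, Real.sqrt_sq dist_nonneg]
  exact dist_triangle _ _ _

theorem dO2_le_dF2_act {lamA lamMu : ℝ} (hlamA : 0 ≤ lamA) (hlamMu : 0 ≤ lamMu)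
    {Q : Matrix (Fin n) (Fin n) ℝ} (hQ : Qᵀ * Q = 1) (Θ₁ Θ₂ : Descriptor n H) :
    dO2 lamA lamMu Θ₁ Θ₂ ≤ dF2 lamA lamMu Θ₁ (act Q Θ₂) := by
  refine csInf_le ⟨0, ?_⟩ ⟨Q, hQ, rfl⟩
  rintro _ ⟨P, -, rfl⟩
  exact dF2_nonneg hlamA hlamMu _ _

theorem le_sqrt_dO2 {lamA lamMu t : ℝ} {Θ₁ Θ₂ : Descriptor n H}
    (h : ∀ Q : Matrix (Fin n) (Fin n) ℝ, Qᵀ * Q = 1 → t ≤ √(dF2 lamA lamMu Θ₁ (act Q Θ₂))) :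
    t ≤ √(dO2 lamA lamMu Θ₁ Θ₂) := by
  rcases le_or_gt t 0 with ht | ht
  · exact ht.trans (Real.sqrt_nonneg _)
  · refine (Real.le_sqrt' ht).mpr (le_csInf ⟨_, 1, by simp, rfl⟩ ?_)
    rintro _ ⟨Q, hQ, rfl⟩
    exact (Real.le_sqrt' ht).mp (h Q hQ)

/-- The alignment metric `d_O = √(d_O²)` satisfies the triangle inequality. -/
theorem dO_triangle (hn : 0 < n) (lamA lamMu : ℝ) (hlamA : 0 < lamA) (hlamMu : 0 < lamMu)
    (Θ₁ Θ₂ Θ₃ : Descriptor n H) :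
    Real.sqrt (dO2 lamA lamMu Θ₁ Θ₃) ≤
      Real.sqrt (dO2 lamA lamMu Θ₁ Θ₂) + Real.sqrt (dO2 lamA lamMu Θ₂ Θ₃) := by
  rw [← sub_le_iff_le_add']
  refine le_sqrt_dO2 fun P hP => ?_
  rw [sub_le_comm]
  refine le_sqrt_dO2 fun Q hQ => ?_
  rw [sub_le_iff_le_add]
  have hPQ : (P * Q)ᵀ * (P * Q) = 1 := by
    rw [Matrix.transpose_mul, Matrix.mul_assoc, ← Matrix.mul_assoc Pᵀ, hP, Matrix.one_mul, hQ]
  calc √(dO2 lamA lamMu Θ₁ Θ₃)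
      ≤ √(dF2 lamA lamMu Θ₁ (act Q (act P Θ₃))) := by
        rw [act_act]
        exact Real.sqrt_le_sqrt (dO2_le_dF2_act hlamA.le hlamMu.le hPQ Θ₁ Θ₃)
    _ ≤ √(dF2 lamA lamMu Θ₁ (act Q Θ₂)) + √(dF2 lamA lamMu (act Q Θ₂) (act Q (act P Θ₃))) :=
        sqrt_dF2_triangle hlamA.le hlamMu.le _ _ _
    _ = √(dF2 lamA lamMu Θ₁ (act Q Θ₂)) + √(dF2 lamA lamMu Θ₂ (act P Θ₃)) := by
        rw [dF2_act_act lamA lamMu hQ]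
end

section
/- The alignment distance is positive definite on orbits: for any two system descriptors Θ₁ = (A₁, C₁, μ₁) and Θ₂ = (A₂, C₂, μ₂), one has d_O(Θ₁, Θ₂)² = 0 if and only if there exists an orthogonal n×n matrix Q with A₁ = QᵀA₂Q, C₁ = C₂·Q and μ₁ = μ₂, i.e., if and only if Θ₁ and Θ₂ lie in the same orbit of the O(n)-action. -/
open Matrix

variable {n : ℕ} {H : Type*} [NormedAddCommGroup H] [InnerProductSpace ℝ H]

/-- The orthogonal group `O(n)` is compact. -/
theorem isCompact_setOf_transpose_mul_self_eq_one (n : ℕ) :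
    IsCompact {Q : Matrix (Fin n) (Fin n) ℝ | Qᵀ * Q = 1} := by
  have hbox : IsCompact {Q : Matrix (Fin n) (Fin n) ℝ | ∀ i j, Q i j ∈ Set.Icc (-1 : ℝ) 1} := by
    have h := isCompact_univ_pi fun _ : Fin n =>
      isCompact_univ_pi fun _ : Fin n => isCompact_Icc (a := (-1 : ℝ)) (b := 1)
    simp only [Set.pi, Set.mem_univ, true_imp_iff, Set.mem_ofPred_eq] at h
    exact h
  refine hbox.of_isClosed_subset (isClosed_eq (by fun_prop) continuous_const) ?_
  intro Q hQ i j
  exact abs_le.mp (entry_norm_bound_of_unitary (mem_unitaryGroup_iff'.mpr hQ) i j)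

theorem trace_transpose_mul_self_nonneg {m : ℕ} (M : Matrix (Fin m) (Fin m) ℝ) :
    0 ≤ trace (Mᵀ * M) := by
  simpa using (posSemidef_conjTranspose_mul_self M).trace_nonneg

theorem dF2_eq_zero_iff {lamA lamMu : ℝ} (hlamA : 0 < lamA) (hlamMu : 0 < lamMu)
    (Θ₁ Θ₂ : Descriptor n H) :
    dF2 lamA lamMu Θ₁ Θ₂ = 0 ↔ Θ₁.A = Θ₂.A ∧ Θ₁.C = Θ₂.C ∧ Θ₁.μ = Θ₂.μ := by
  have hA := trace_transpose_mul_self_nonneg (Θ₁.A - Θ₂.A)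
  have htrace : trace ((Θ₁.A - Θ₂.A)ᵀ * (Θ₁.A - Θ₂.A)) = 0 ↔ Θ₁.A = Θ₂.A := by
    simpa [sub_eq_zero] using trace_conjTranspose_mul_self_eq_zero_iff (A := Θ₁.A - Θ₂.A)
  have hsum : ∑ j, ‖Θ₁.C j - Θ₂.C j‖ ^ 2 = 0 ↔ Θ₁.C = Θ₂.C := by
    rw [Finset.sum_eq_zero_iff_of_nonneg fun j _ => by positivity]
    simp [sub_eq_zero, funext_iff]
  unfold dF2
  rw [add_eq_zero_iff_of_nonneg (by positivity) (by positivity),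
    add_eq_zero_iff_of_nonneg (by positivity) (by positivity), hsum, and_assoc,
    mul_eq_zero_iff_left hlamA.ne', htrace]
  simp [hlamMu.ne', sub_eq_zero]

theorem continuous_dF2_act (lamA lamMu : ℝ) (Θ₁ Θ₂ : Descriptor n H) :
    Continuous fun Q : Matrix (Fin n) (Fin n) ℝ => dF2 lamA lamMu Θ₁ (act Q Θ₂) := by
  unfold dF2 act
  fun_prop

/-- The infimum defining the alignment distance is attained. -/
theorem exists_dO2_eq_dF2_act (lamA lamMu : ℝ) (Θ₁ Θ₂ : Descriptor n H) :
    ∃ Q : Matrix (Fin n) (Fin n) ℝ, Qᵀ * Q = 1 ∧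
      dO2 lamA lamMu Θ₁ Θ₂ = dF2 lamA lamMu Θ₁ (act Q Θ₂) := by
  obtain ⟨Q, hQ, h, -⟩ := (isCompact_setOf_transpose_mul_self_eq_one n).exists_sInf_image_eq_and_le
    ⟨1, by simp⟩ (continuous_dF2_act lamA lamMu Θ₁ Θ₂).continuousOn
  refine ⟨Q, hQ, ?_⟩
  rw [← h, dO2]
  congr 1
  ext d
  simp [eq_comm]

/-- Positive definiteness on orbits: `d_O(Θ₁,Θ₂)² = 0` iff `Θ₁` and `Θ₂` lie in the
same orbit of the `O(n)`-action. -/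
theorem dO2_eq_zero_iff (hn : 0 < n) (lamA lamMu : ℝ) (hlamA : 0 < lamA) (hlamMu : 0 < lamMu)
    (Θ₁ Θ₂ : Descriptor n H) :
    dO2 lamA lamMu Θ₁ Θ₂ = 0 ↔
      ∃ Q : Matrix (Fin n) (Fin n) ℝ, Qᵀ * Q = 1 ∧
        Θ₁.A = Qᵀ * Θ₂.A * Q ∧ Θ₁.C = (fun j => ∑ i, Q i j • Θ₂.C i) ∧ Θ₁.μ = Θ₂.μ := by
  constructor
  · intro h
    obtain ⟨Q, hQ, hd⟩ := exists_dO2_eq_dF2_act lamA lamMu Θ₁ Θ₂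
    exact ⟨Q, hQ, (dF2_eq_zero_iff hlamA hlamMu Θ₁ (act Q Θ₂)).mp (hd.symm.trans h)⟩
  · rintro ⟨Q, hQ, h⟩
    refine IsLeast.csInf_eq ⟨⟨Q, hQ, ((dF2_eq_zero_iff hlamA hlamMu Θ₁ (act Q Θ₂)).mpr h).symm⟩, ?_⟩
    rintro _ ⟨R, -, rfl⟩
    exact dF2_nonneg hlamA.le hlamMu.le _ _
end

section
/- Let k₀, k₁, k₂, k₃, k₄ be real numbers, let ε ∈ {1, −1}, and define g : (−1, 1) → ℝ by g(s) = (k₁ − k₀)s² + ε(k₂s + k₃)√(1 − s²) + k₄s. If s ∈ (−1, 1) and the derivative of g vanishes at s, then s is a root of the quartic polynomial: −4((k₁−k₀)² + k₂²)s⁴ − 4(k₄(k₁−k₀) + k₂k₃)s³ + (4(k₁−k₀)² + 4k₂² − k₄² − k₃²)s² + 2(2k₄(k₁−k₀) + k₂k₃)s + (k₄² − k₂²) = 0. -/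
/-- The derivative of `(k₁−k₀)x² + ε(k₂x + k₃)√(1−x²) + k₄x` at an interior point of `[-1, 1]`. -/
theorem hasDerivAt_givens_cost (k₀ k₁ k₂ k₃ k₄ ε : ℝ) {s : ℝ} (hs : 0 < 1 - s ^ 2) :
    HasDerivAt (fun x : ℝ =>
        (k₁ - k₀) * x ^ 2 + ε * (k₂ * x + k₃) * Real.sqrt (1 - x ^ 2) + k₄ * x)
      (2 * (k₁ - k₀) * s + ε * (k₂ * Real.sqrt (1 - s ^ 2)
        - (k₂ * s + k₃) * s / Real.sqrt (1 - s ^ 2)) + k₄) s := by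
  have hid := hasDerivAt_id' s
  have hsqrt := ((hid.pow 2).const_sub 1).sqrt hs.ne'
  have hlin := ((hid.const_mul k₂).add_const k₃).const_mul ε
  have hr : Real.sqrt (1 - s ^ 2) ≠ 0 := (Real.sqrt_pos.2 hs).ne'
  refine ((((hid.pow 2).const_mul (k₁ - k₀)).add (hlin.mul hsqrt)).add
    (hid.const_mul k₄)).congr_deriv ?_
  simp only [Pi.pow_apply]
  field_simp
  ring

/-- Any interior critical point of
`g(s) = (k₁−k₀)s² + ε(k₂s + k₃)√(1−s²) + k₄s` (with `ε = ±1`) is a root of the quartic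
polynomial obtained by setting the derivative to zero, multiplying by `±√(1−s²)`,
and squaring. -/
theorem critical_point_satisfies_quartic
    (k₀ k₁ k₂ k₃ k₄ : ℝ) (ε : ℝ) (hε : ε = 1 ∨ ε = -1)
    (s : ℝ) (hs₁ : -1 < s) (hs₂ : s < 1)
    (hcrit : deriv (fun x : ℝ =>
        (k₁ - k₀) * x ^ 2 + ε * (k₂ * x + k₃) * Real.sqrt (1 - x ^ 2) + k₄ * x) s = 0) :
    -4 * ((k₁ - k₀) ^ 2 + k₂ ^ 2) * s ^ 4 - 4 * (k₄ * (k₁ - k₀) + k₂ * k₃) * s ^ 3 +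
        (4 * (k₁ - k₀) ^ 2 + 4 * k₂ ^ 2 - k₄ ^ 2 - k₃ ^ 2) * s ^ 2 +
        2 * (2 * k₄ * (k₁ - k₀) + k₂ * k₃) * s + (k₄ ^ 2 - k₂ ^ 2) = 0 := by
  have hs : 0 < 1 - s ^ 2 := by nlinarith
  rw [(hasDerivAt_givens_cost k₀ k₁ k₂ k₃ k₄ ε hs).deriv] at hcrit
  have hr : Real.sqrt (1 - s ^ 2) ≠ 0 := (Real.sqrt_pos.2 hs).ne'
  have hr2 : Real.sqrt (1 - s ^ 2) ^ 2 = 1 - s ^ 2 := Real.sq_sqrt hs.le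
  have hε2 : ε ^ 2 = 1 := by rcases hε with rfl | rfl <;> norm_num
  generalize Real.sqrt (1 - s ^ 2) = r at hcrit hr hr2
  have hmul : (2 * (k₁ - k₀) * s + k₄) * r = -ε * (k₂ * (1 - 2 * s ^ 2) - k₃ * s) := by
    field_simp at hcrit
    linear_combination hcrit - ε * k₂ * hr2
  have hsq := congrArg (· ^ 2) hmul
  simp only [mul_pow, neg_sq, hr2, hε2] at hsq
  linear_combination hsq
end
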